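/- Let H ∈ (3/4, 1) and θ > 0. Then lim_{T → ∞} T^{2-4H} ∫_{[0,T]^4} e^{-θ|s₂-u₂| - θ|s₁-u₁|} |s₂-s₁|^{2H-2} |u₂-u₁|^{2H-2} du₁ du₂ ds₁ ds₂ = 8 θ^{-2} / ((4H-2)(4H-3)). -/

import Mathlib

open MeasureTheory

section Translation

variable {G : Type*} [NormedAddCommGroup G] [MeasurableSpace G] [BorelSpace G]
  {μ : Measure G} [μ.IsAddRightInvariant]

/-- The autocorrelation of a square integrable function is an inner product in `L²`. -/
lemma integral_mul_translate_eq_inner {f : G → ℝ} (hf : MemLp f 2 μ) (w : G) :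
    ∫ x, f x * f (x + w) ∂μ =
      inner ℝ (hf.toLp f)
        (Lp.compMeasurePreserving (· + w) (measurePreserving_add_right μ w) (hf.toLp f)) := by
  rw [L2.inner_def, Lp.toLp_compMeasurePreserving]
  refine integral_congr_ae ?_
  filter_upwards [hf.coeFn_toLp,
    (hf.comp_measurePreserving (measurePreserving_add_right μ w)).coeFn_toLp] with x h1 h2
  rw [h1, h2]
  simp [mul_comm]

/-- The autocorrelation of a square integrable function is bounded by its value at `0`. -/
lemma norm_integral_mul_translate_le {f : G → ℝ} (hf : MemLp f 2 μ) (w : G) :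
    ‖∫ x, f x * f (x + w) ∂μ‖ ≤ ‖hf.toLp f‖ * ‖hf.toLp f‖ := by
  rw [integral_mul_translate_eq_inner hf]
  refine (norm_inner_le_norm _ _).trans_eq ?_
  rw [Lp.norm_compMeasurePreserving]

variable [IsLocallyFiniteMeasure μ] [μ.InnerRegularCompactLTTop]

/-- The autocorrelation of a square integrable function is continuous. -/
lemma continuous_integral_mul_translate {f : G → ℝ} (hf : MemLp f 2 μ) :
    Continuous fun w => ∫ x, f x * f (x + w) ∂μ := by
  simp_rw [integral_mul_translate_eq_inner hf]
  refine continuous_const.inner ?_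
  have hg : Continuous fun w : G => (⟨fun x => x + w, by fun_prop⟩ : C(G, G)) :=
    (ContinuousMap.curry ⟨fun p : G × G => p.2 + p.1, by fun_prop⟩).continuous
  exact (continuous_const (y := hf.toLp f)).compMeasurePreservingLp hg
    (fun w => measurePreserving_add_right μ w) (by norm_num)

end Translation

section Laplace

lemma integral_exp_neg_mul_abs {θ : ℝ} (hθ : 0 < θ) : ∫ x : ℝ, Real.exp (-θ * |x|) = 2 / θ := by
  rw [integral_comp_abs (f := fun x => Real.exp (-θ * x)),
    integral_exp_mul_Ioi (neg_lt_zero.2 hθ)]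
  simp
  ring

lemma integrable_exp_neg_mul_abs {θ : ℝ} (hθ : 0 < θ) :
    Integrable fun x : ℝ => Real.exp (-θ * |x|) := by
  refine Integrable.of_integral_ne_zero ?_
  rw [integral_exp_neg_mul_abs hθ]
  positivity

/-- The planar Laplace kernel `exp (-θ (|v₁| + |v₂|))`. -/
noncomputable def laplaceKernel (θ : ℝ) (v : ℝ × ℝ) : ℝ :=
  Real.exp (-θ * |v.1|) * Real.exp (-θ * |v.2|)

lemma continuous_laplaceKernel (θ : ℝ) : Continuous (laplaceKernel θ) := by
  unfold laplaceKernel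
  fun_prop

lemma norm_laplaceKernel_le_one {θ : ℝ} (hθ : 0 < θ) (v : ℝ × ℝ) : ‖laplaceKernel θ v‖ ≤ 1 := by
  rw [laplaceKernel, ← Real.exp_add, Real.norm_eq_abs, Real.abs_exp, Real.exp_le_one_iff]
  nlinarith [abs_nonneg v.1, abs_nonneg v.2]

lemma integrable_laplaceKernel {θ : ℝ} (hθ : 0 < θ) : Integrable (laplaceKernel θ) :=
  (integrable_exp_neg_mul_abs hθ).mul_prod (integrable_exp_neg_mul_abs hθ)

lemma integral_laplaceKernel {θ : ℝ} (hθ : 0 < θ) : ∫ v, laplaceKernel θ v = (2 / θ) ^ 2 := by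
  simp only [laplaceKernel]
  rw [Measure.volume_eq_prod,
    integral_prod_mul (fun x : ℝ => Real.exp (-θ * |x|)) fun x : ℝ => Real.exp (-θ * |x|),
    integral_exp_neg_mul_abs hθ, sq]

end Laplace

section RieszKernel

lemma intervalIntegrable_abs_rpow {b : ℝ} (hb : -1 < b) (x y : ℝ) :
    IntervalIntegrable (fun t : ℝ => |t| ^ b) volume x y := by
  refine intervalIntegrable_of_even (fun t => by rw [abs_neg]) fun t ht => ?_
  refine (intervalIntegral.intervalIntegrable_rpow' hb).congr fun s hs => ?_
  rw [Set.uIoc_of_le ht.le] at hs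
  simp only [abs_of_pos hs.1]

/-- The kernel `|x₂ - x₁| ^ b` restricted to the square `(0, T]²`. -/
noncomputable def squareRieszKernel (b T : ℝ) : ℝ × ℝ → ℝ :=
  (Set.Ioc 0 T ×ˢ Set.Ioc 0 T).indicator fun p => |p.2 - p.1| ^ b

lemma measurable_squareRieszKernel (b T : ℝ) : Measurable (squareRieszKernel b T) := by
  refine Measurable.indicator ?_ (measurableSet_Ioc.prod measurableSet_Ioc)
  fun_prop

lemma integrable_squareRieszKernel {b : ℝ} (hb : -1 < b) (T : ℝ) :
    Integrable (squareRieszKernel b T) := by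
  rcases le_or_gt T 0 with hT | hT
  · simp [squareRieszKernel, Set.Ioc_eq_empty_of_le hT]
  have hone : Integrable ((Set.Ioc 0 T).indicator fun _ : ℝ => (1 : ℝ)) :=
    (integrableOn_const (by simp)).integrable_indicator measurableSet_Ioc
  have hpow : Integrable ((Set.Ioc (-T) T).indicator fun t : ℝ => |t| ^ b) :=
    ((intervalIntegrable_iff_integrableOn_Ioc_of_le (by linarith)).1
      (intervalIntegrable_abs_rpow hb (-T) T)).integrable_indicator measurableSet_Ioc
  refine (hone.convolution_integrand (ContinuousLinearMap.mul ℝ ℝ) hpow).mono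
    (measurable_squareRieszKernel b T).aestronglyMeasurable (.of_forall fun p => ?_)
  by_cases hp : p ∈ Set.Ioc 0 T ×ˢ Set.Ioc 0 T
  · obtain ⟨h1, h2⟩ := hp
    have h3 : p.1 - p.2 ∈ Set.Ioc (-T) T := ⟨by linarith [h1.1, h2.2], by linarith [h1.2, h2.1]⟩
    simp [squareRieszKernel, h1, h2, h3, Set.indicator_of_mem, abs_sub_comm p.2 p.1,
      -Set.mem_Ioc]
  · rw [squareRieszKernel, Set.indicator_of_notMem hp, norm_zero]
    exact norm_nonneg _

lemma squareRieszKernel_sq (a T : ℝ) (x : ℝ × ℝ) :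
    squareRieszKernel a T x ^ 2 = squareRieszKernel (2 * a) T x := by
  by_cases hx : x ∈ Set.Ioc 0 T ×ˢ Set.Ioc 0 T
  · simp only [squareRieszKernel, Set.indicator_of_mem hx]
    rw [← Real.rpow_mul_natCast (abs_nonneg _)]
    ring_nf
  · simp [squareRieszKernel, Set.indicator_of_notMem hx]

lemma memLp_two_squareRieszKernel {a : ℝ} (ha : -1 < 2 * a) (T : ℝ) :
    MemLp (squareRieszKernel a T) 2 := by
  rw [memLp_two_iff_integrable_sq (measurable_squareRieszKernel a T).aestronglyMeasurable]
  simp_rw [squareRieszKernel_sq]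
  exact integrable_squareRieszKernel ha T

lemma squareRieszKernel_smul (a : ℝ) {T : ℝ} (hT : 0 < T) (x : ℝ × ℝ) :
    squareRieszKernel a T (T • x) = T ^ a * squareRieszKernel a 1 x := by
  have hmem : T • x ∈ Set.Ioc 0 T ×ˢ Set.Ioc 0 T ↔ x ∈ Set.Ioc (0 : ℝ) 1 ×ˢ Set.Ioc (0 : ℝ) 1 := by
    simp [Set.mem_prod, hT]
  by_cases hx : x ∈ Set.Ioc (0 : ℝ) 1 ×ˢ Set.Ioc (0 : ℝ) 1
  · rw [squareRieszKernel, squareRieszKernel, Set.indicator_of_mem hx,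
      Set.indicator_of_mem (hmem.2 hx)]
    simp only [Prod.smul_snd, Prod.smul_fst, smul_eq_mul]
    rw [← mul_sub, abs_mul, abs_of_pos hT, Real.mul_rpow hT.le (abs_nonneg _)]
  · rw [squareRieszKernel, squareRieszKernel, Set.indicator_of_notMem hx,
      Set.indicator_of_notMem (hmem.not.2 hx), mul_zero]

/-- Scaling of the autocorrelation of the kernel `|x₂ - x₁| ^ a` on the square `(0, T]²`. -/
lemma integral_squareRieszKernel_mul_translate (a : ℝ) {T : ℝ} (hT : 0 < T) (v : ℝ × ℝ) :
    ∫ s, squareRieszKernel a T s * squareRieszKernel a T (s + v) =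
      T ^ (2 + 2 * a) *
        ∫ x, squareRieszKernel a 1 x * squareRieszKernel a 1 (x + T⁻¹ • v) := by
  have key := Measure.integral_comp_smul (volume : Measure (ℝ × ℝ))
    (fun s => squareRieszKernel a T s * squareRieszKernel a T (s + v)) T
  have hpt : ∀ x : ℝ × ℝ, squareRieszKernel a T (T • x) * squareRieszKernel a T (T • x + v) =
      T ^ (2 * a) * (squareRieszKernel a 1 x * squareRieszKernel a 1 (x + T⁻¹ • v)) := by
    intro x
    have hv : T • x + v = T • (x + T⁻¹ • v) := by
      rw [smul_add, smul_inv_smul₀ hT.ne']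
    rw [hv, squareRieszKernel_smul a hT, squareRieszKernel_smul a hT, two_mul a,
      Real.rpow_add hT]
    ring
  simp_rw [hpt] at key
  rw [integral_const_mul] at key
  rw [Real.rpow_add hT, mul_assoc, key]
  have : |(T ^ Module.finrank ℝ (ℝ × ℝ))⁻¹| = (T ^ 2)⁻¹ := by
    rw [Module.finrank_prod, Module.finrank_self, abs_of_pos (by positivity)]
  rw [this, smul_eq_mul, Real.rpow_two, mul_inv_cancel_left₀ (by positivity)]

lemma intervalIntegral_eq_integral_indicator {g : ℝ × ℝ → ℝ} {T : ℝ} (hT : 0 ≤ T)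
    (hg : Integrable ((Set.Ioc 0 T ×ˢ Set.Ioc 0 T).indicator g)) :
    ∫ x in (0 : ℝ)..T, ∫ y in (0 : ℝ)..T, g (x, y) =
      ∫ p, (Set.Ioc 0 T ×ˢ Set.Ioc 0 T).indicator g p := by
  have hmeas : MeasurableSet (Set.Ioc 0 T ×ˢ Set.Ioc 0 T) :=
    measurableSet_Ioc.prod measurableSet_Ioc
  rw [integrable_indicator_iff hmeas, Measure.volume_eq_prod] at hg
  rw [integral_indicator hmeas, Measure.volume_eq_prod, setIntegral_prod g hg]
  simp_rw [intervalIntegral.integral_of_le hT]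

lemma intervalIntegral_abs_sub_rpow {b : ℝ} (hb : -1 < b) {x : ℝ} (hx : x ∈ Set.Icc (0 : ℝ) 1) :
    ∫ y in (0 : ℝ)..1, |y - x| ^ b = (x ^ (b + 1) + (1 - x) ^ (b + 1)) / (b + 1) := by
  have hpos : ∀ {c : ℝ}, 0 ≤ c → ∫ t in (0 : ℝ)..c, |t| ^ b = c ^ (b + 1) / (b + 1) := by
    intro c hc
    have h : ∫ t in (0 : ℝ)..c, |t| ^ b = ∫ t in (0 : ℝ)..c, t ^ b := by
      refine intervalIntegral.integral_congr fun t ht => ?_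
      rw [Set.uIcc_of_le hc] at ht
      simp only [abs_of_nonneg ht.1]
    rw [h, integral_rpow (Or.inl hb), Real.zero_rpow (by linarith), sub_zero]
  rw [intervalIntegral.integral_comp_sub_right (fun t => |t| ^ b) x,
    ← intervalIntegral.integral_add_adjacent_intervals (intervalIntegrable_abs_rpow hb _ 0)
      (intervalIntegrable_abs_rpow hb 0 _), hpos (sub_nonneg.2 hx.2)]
  have hneg := intervalIntegral.integral_comp_neg (a := 0) (b := x) fun t : ℝ => |t| ^ b
  simp only [abs_neg, neg_zero] at hneg
  rw [zero_sub, ← hneg, hpos hx.1, ← add_div]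

lemma integral_squareRieszKernel_one {b : ℝ} (hb : -1 < b) :
    ∫ x, squareRieszKernel b 1 x = 2 / ((b + 2) * (b + 1)) := by
  rw [squareRieszKernel, ← intervalIntegral_eq_integral_indicator zero_le_one
    (integrable_squareRieszKernel hb 1)]
  have h : ∫ x in (0 : ℝ)..1, ∫ y in (0 : ℝ)..1, |y - x| ^ b =
      ∫ x in (0 : ℝ)..1, (x ^ (b + 1) + (1 - x) ^ (b + 1)) / (b + 1) := by
    refine intervalIntegral.integral_congr fun x hx => ?_
    rw [Set.uIcc_of_le zero_le_one] at hx
    exact intervalIntegral_abs_sub_rpow hb hx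
  have hb' : -1 < b + 1 := by linarith
  have hint : IntervalIntegrable (fun x : ℝ => x ^ (b + 1)) volume 0 1 :=
    intervalIntegral.intervalIntegrable_rpow' hb'
  have hint' : IntervalIntegrable (fun x : ℝ => (1 - x) ^ (b + 1)) volume 0 1 := by
    simpa using (hint.comp_sub_left 1).symm
  rw [h, intervalIntegral.integral_div, intervalIntegral.integral_add hint hint',
    intervalIntegral.integral_comp_sub_left (fun t => t ^ (b + 1)) 1, sub_self, sub_zero,
    integral_rpow (Or.inl hb'), Real.zero_rpow (by linarith), Real.one_rpow]
  have h1 : b + 1 ≠ 0 := by linarith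
  have h2 : b + 2 ≠ 0 := by linarith
  have h3 : b + 1 + 1 ≠ 0 := by linarith
  field_simp
  ring

end RieszKernel

section Fourfold

lemma integrable_mul_laplaceKernel_mul {θ : ℝ} (hθ : 0 < θ) {f : ℝ × ℝ → ℝ} (hf : Integrable f) :
    Integrable (fun p : (ℝ × ℝ) × (ℝ × ℝ) => laplaceKernel θ (p.2 - p.1) * (f p.1 * f p.2))
      (volume.prod volume) := by
  refine (hf.mul_prod hf).bdd_mul (c := 1) ?_ (.of_forall fun p => norm_laplaceKernel_le_one hθ _)
  exact ((continuous_laplaceKernel θ).comp (continuous_snd.sub continuous_fst)).aestronglyMeasurable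

lemma integral_integral_laplaceKernel {θ : ℝ} (hθ : 0 < θ) {f : ℝ × ℝ → ℝ} (hf : Integrable f) :
    ∫ s, ∫ u, laplaceKernel θ (u - s) * (f s * f u) =
      ∫ v, laplaceKernel θ v * ∫ s, f s * f (s + v) := by
  have hint := (measurePreserving_prod_add (volume : Measure (ℝ × ℝ))
    volume).integrable_comp_of_integrable (integrable_mul_laplaceKernel_mul hθ hf)
  calc ∫ s, ∫ u, laplaceKernel θ (u - s) * (f s * f u)
      = ∫ s, ∫ v, laplaceKernel θ v * (f s * f (s + v)) := by
        congr 1 with s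
        rw [← integral_add_left_eq_self _ s]
        simp
    _ = ∫ v, ∫ s, laplaceKernel θ v * (f s * f (s + v)) := by
        refine integral_integral_swap ?_
        simpa [Function.comp_def, Function.uncurry_def] using hint
    _ = _ := by simp_rw [integral_const_mul]

lemma intervalIntegral_fourfold_eq {a θ T : ℝ} (ha : -1 < a) (hθ : 0 < θ) (hT : 0 ≤ T) :
    ∫ s₁ in (0:ℝ)..T, ∫ s₂ in (0:ℝ)..T, ∫ u₁ in (0:ℝ)..T, ∫ u₂ in (0:ℝ)..T,
      Real.exp (-θ * |s₂ - u₂| - θ * |s₁ - u₁|) * |s₂ - s₁| ^ a * |u₂ - u₁| ^ a =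
    ∫ v, laplaceKernel θ v * ∫ s, squareRieszKernel a T s * squareRieszKernel a T (s + v) := by
  set Q : Set (ℝ × ℝ) := Set.Ioc 0 T ×ˢ Set.Ioc 0 T with hQ
  set f := squareRieszKernel a T with hf
  have hfi : Integrable f := integrable_squareRieszKernel ha T
  have hinner : ∀ s₁ s₂ : ℝ, ∫ u₁ in (0:ℝ)..T, ∫ u₂ in (0:ℝ)..T,
      Real.exp (-θ * |s₂ - u₂| - θ * |s₁ - u₁|) * |s₂ - s₁| ^ a * |u₂ - u₁| ^ a =
      ∫ u, laplaceKernel θ (u - (s₁, s₂)) * (|s₂ - s₁| ^ a * f u) := by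
    intro s₁ s₂
    have hind : Q.indicator (fun u : ℝ × ℝ =>
        Real.exp (-θ * |s₂ - u.2| - θ * |s₁ - u.1|) * |s₂ - s₁| ^ a * |u.2 - u.1| ^ a) =
        fun u => laplaceKernel θ (u - (s₁, s₂)) * (|s₂ - s₁| ^ a * f u) := by
      ext u
      by_cases hu : u ∈ Q
      · rw [hf, squareRieszKernel, Set.indicator_of_mem hu, Set.indicator_of_mem hu, laplaceKernel,
          ← Real.exp_add, Prod.fst_sub, Prod.snd_sub, abs_sub_comm u.1 s₁,
          abs_sub_comm u.2 s₂, sub_eq_add_neg, ← neg_mul, add_comm (-θ * |s₂ - u.2|)]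
        ring
      · rw [hf, squareRieszKernel, Set.indicator_of_notMem hu, Set.indicator_of_notMem hu]
        simp
    rw [← hind, ← intervalIntegral_eq_integral_indicator hT]
    rw [← hQ, hind]
    refine (hfi.const_mul _).bdd_mul (c := 1) ?_
      (.of_forall fun p => norm_laplaceKernel_le_one hθ _)
    exact ((continuous_laplaceKernel θ).comp
      (continuous_id.sub continuous_const)).aestronglyMeasurable
  have hind : Q.indicator (fun s : ℝ × ℝ =>
      ∫ u, laplaceKernel θ (u - (s.1, s.2)) * (|s.2 - s.1| ^ a * f u)) =
      fun s => ∫ u, laplaceKernel θ (u - s) * (f s * f u) := by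
    ext s
    by_cases hs : s ∈ Q
    · have : f s = |s.2 - s.1| ^ a := Set.indicator_of_mem hs _
      rw [Set.indicator_of_mem hs, this]
    · have : f s = 0 := Set.indicator_of_notMem hs _
      rw [Set.indicator_of_notMem hs, this]
      simp
  simp_rw [hinner]
  rw [← integral_integral_laplaceKernel hθ hfi, ← hind]
  refine intervalIntegral_eq_integral_indicator (g := fun s : ℝ × ℝ =>
      ∫ u, laplaceKernel θ (u - (s.1, s.2)) * (|s.2 - s.1| ^ a * f u)) hT ?_
  rw [← hQ, hind]
  exact (integrable_mul_laplaceKernel_mul hθ hfi).integral_prod_left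

/-- Concentration of the rescaled Laplace kernel at the origin. -/
lemma tendsto_integral_laplaceKernel_mul {θ : ℝ} (hθ : 0 < θ) {g : ℝ × ℝ → ℝ} {C : ℝ}
    (hg : Continuous g) (hC : ∀ w, ‖g w‖ ≤ C) :
    Filter.Tendsto (fun T : ℝ => ∫ v, laplaceKernel θ v * g (T⁻¹ • v)) Filter.atTop
      (nhds ((2 / θ) ^ 2 * g 0)) := by
  rw [← integral_laplaceKernel hθ, ← integral_mul_const]
  refine tendsto_integral_filter_of_dominated_convergence (fun v => ‖laplaceKernel θ v‖ * C)
    (.of_forall fun T => ?_) (.of_forall fun T => .of_forall fun v => ?_)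
    ((integrable_laplaceKernel hθ).norm.mul_const C) (.of_forall fun v => ?_)
  · exact ((continuous_laplaceKernel θ).mul
      (hg.comp (continuous_const_smul T⁻¹))).aestronglyMeasurable
  · rw [norm_mul]
    exact mul_le_mul_of_nonneg_left (hC _) (norm_nonneg _)
  · refine ((hg.tendsto 0).comp ?_).const_mul _
    simpa using (tendsto_inv_atTop_zero (𝕜 := ℝ)).smul_const v

end Fourfold

/-- For `H ∈ (3/4, 1)`, `lim_{T→∞} T^{2-4H} I_T = 8 θ^{-2}/((4H-2)(4H-3))`. -/
theorem limit_IT_supercritical (H θ : ℝ) (hH : H ∈ Set.Ioo (3/4 : ℝ) 1) (hθ : 0 < θ) :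
    Filter.Tendsto (fun T : ℝ =>
      T ^ (2 - 4*H) *
        ∫ s₁ in (0:ℝ)..T, ∫ s₂ in (0:ℝ)..T, ∫ u₁ in (0:ℝ)..T, ∫ u₂ in (0:ℝ)..T,
          Real.exp (-θ * |s₂ - u₂| - θ * |s₁ - u₁|) *
            |s₂ - s₁| ^ (2*H - 2) * |u₂ - u₁| ^ (2*H - 2))
      Filter.atTop (nhds (8 / θ^2 / ((4*H - 2) * (4*H - 3)))) := by
  have ha : -1 < 2 * (2 * H - 2) := by linarith [hH.1]
  have hL2 := memLp_two_squareRieszKernel ha 1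
  have hlim := tendsto_integral_laplaceKernel_mul hθ (continuous_integral_mul_translate hL2)
    (norm_integral_mul_translate_le hL2)
  have hval : (2 / θ) ^ 2 * ∫ x, squareRieszKernel (2 * H - 2) 1 x *
      squareRieszKernel (2 * H - 2) 1 (x + 0) = 8 / θ ^ 2 / ((4 * H - 2) * (4 * H - 3)) := by
    simp_rw [add_zero, ← sq, squareRieszKernel_sq]
    rw [integral_squareRieszKernel_one ha]
    ring_nf
  rw [hval] at hlim
  refine hlim.congr' ?_
  filter_upwards [Filter.eventually_gt_atTop 0] with T hT
  rw [intervalIntegral_fourfold_eq (by linarith [hH.1]) hθ hT.le]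
  simp_rw [integral_squareRieszKernel_mul_translate _ hT, mul_left_comm (laplaceKernel θ _)]
  rw [integral_const_mul, ← mul_assoc, ← Real.rpow_add hT]
  ring_nf
  simp
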